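/- arXiv:1806.00586 — 9 statements merged into one kernel-verified Lean document; each statement's English description precedes it below -/
import Mathlib

section
/- Let V be a finite type, r : V → V → Prop a binary relation (digraph), and S : Set V. Then every vertex of V is reachable from some vertex of S (i.e., ∀ v, ∃ u ∈ S, Relation.ReflTransGen r u v) if and only if every source strongly connected component of r has nonempty intersection with S. -/
/-- A set `C` is a source strongly connected component (SSCC) of the digraph `r`. -/
def IsSSCC {V : Type*} (r : V → V → Prop) (C : Set V) : Prop :=
  ∃ v : V, C = {u | Relation.ReflTransGen r u v ∧ Relation.ReflTransGen r v u} ∧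
    ∀ w : V, Relation.ReflTransGen r w v → Relation.ReflTransGen r v w

/-- In a finite digraph, every vertex is reachable from some vertex `x` which reaches every
vertex that reaches it. -/
theorem exists_reflTransGen_source {V : Type*} [Finite V] (r : V → V → Prop) (v : V) :
    ∃ x, Relation.ReflTransGen r x v ∧
      ∀ w, Relation.ReflTransGen r w x → Relation.ReflTransGen r x w := by
  let _ : Preorder V :=
    { le := Relation.ReflTransGen r
      le_refl := fun _ => .refl
      le_trans := fun _ _ _ => .trans }
  obtain ⟨x, hxv, hx⟩ := Set.finite_univ.exists_le_minimal (Set.mem_univ v)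
  exact ⟨x, hxv, fun w hw => hx.2 (Set.mem_univ w) hw⟩

/-- Every vertex of `V` is reachable from a vertex of `S` iff every source strongly
connected component of `r` meets `S`. -/
theorem reachable_from_set_iff_meets_ssccs {V : Type*} [Finite V]
    (r : V → V → Prop) (S : Set V) :
    (∀ v : V, ∃ u ∈ S, Relation.ReflTransGen r u v) ↔
      ∀ C : Set V, IsSSCC r C → (C ∩ S).Nonempty := by
  constructor
  · rintro h C ⟨v, rfl, hv⟩
    obtain ⟨u, hu, huv⟩ := h v
    exact ⟨u, ⟨huv, hv u huv⟩, hu⟩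
  · intro h v
    obtain ⟨x, hxv, hx⟩ := exists_reflTransGen_source r v
    obtain ⟨u, ⟨hux, -⟩, hu⟩ := h _ ⟨x, rfl, hx⟩
    exact ⟨u, hu, hux.trans hxv⟩
end

section
/- Let V be a finite type, r : V → V → Prop a digraph, U a finite type of inputs, and E_B : Finset (V × U) a set of available input-connections. Suppose the set of source strongly connected components of r is finite with cardinality q, and every source strongly connected component of r contains a vertex v with (v, u) ∈ E_B for some u. Then the minimum of |F| over all subsets F ⊆ E_B that are accessible equals q; that is, there exists an accessible F ⊆ E_B with |F| = q, and every accessible F' ⊆ E_B satisfies |F'| ≥ q. -/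
/-- A set of input-connections `F` is accessible if every vertex is reachable from
some vertex hit by an input-connection of `F`. -/
def Accessible {V U : Type*} (r : V → V → Prop) (F : Finset (V × U)) : Prop :=
  ∀ v : V, ∃ x : V, (∃ u : U, (x, u) ∈ F) ∧ Relation.ReflTransGen r x v

section

variable {V U : Type*} {r : V → V → Prop}

theorem IsSSCC.eq_setOf_of_mem {C : Set V} (hC : IsSSCC r C) {x : V} (hx : x ∈ C) :
    C = {u | Relation.ReflTransGen r u x ∧ Relation.ReflTransGen r x u} := by
  obtain ⟨v, rfl, -⟩ := hC
  ext u
  exact ⟨fun hu => ⟨hu.1.trans hx.2, hx.1.trans hu.2⟩,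
    fun hu => ⟨hu.1.trans hx.1, hx.2.trans hu.2⟩⟩

/-- In a finite digraph every vertex is reachable from all vertices of some SSCC. -/
theorem exists_isSSCC_reaching [Finite V] (r : V → V → Prop) (v : V) :
    ∃ C, IsSSCC r C ∧ ∀ x ∈ C, Relation.ReflTransGen r x v := by
  let _ : Preorder V :=
    { le := Relation.ReflTransGen r
      le_refl := fun _ => Relation.ReflTransGen.refl
      le_trans := fun _ _ _ => Relation.ReflTransGen.trans }
  obtain ⟨m, hmv, hm⟩ := (Set.toFinite (Set.univ : Set V)).exists_le_minimal (Set.mem_univ v)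
  exact ⟨_, ⟨m, rfl, fun w hw => hm.2 (Set.mem_univ w) hw⟩, fun x hx => hx.1.trans hmv⟩

theorem accessible_iff_forall_isSSCC [Finite V] {F : Finset (V × U)} :
    Accessible r F ↔ ∀ C, IsSSCC r C → ∃ v ∈ C, ∃ u, (v, u) ∈ F := by
  constructor
  · rintro hF C ⟨v, rfl, hv⟩
    obtain ⟨x, hx, hxv⟩ := hF v
    exact ⟨x, ⟨hxv, hv x hxv⟩, hx⟩
  · intro h v
    obtain ⟨C, hC, hCv⟩ := exists_isSSCC_reaching r v
    obtain ⟨x, hxC, hx⟩ := h C hC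
    exact ⟨x, hx, hCv x hxC⟩

/-- An accessible set of input-connections contains an accessible subset with exactly one
input-connection per SSCC. -/
theorem Accessible.exists_subset_card_eq [Finite V] {F : Finset (V × U)}
    (hF : Accessible r F) :
    ∃ G ⊆ F, Accessible r G ∧ G.card = {C : Set V | IsSSCC r C}.ncard := by
  classical
  choose x hxC u hxu using fun C : {C : Set V | IsSSCC r C} =>
    accessible_iff_forall_isSSCC.1 hF C C.2
  have := Fintype.ofFinite {C : Set V | IsSSCC r C}
  refine ⟨Finset.univ.image fun C => (x C, u C), ?_, ?_, ?_⟩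
  · intro p hp
    obtain ⟨C, -, rfl⟩ := Finset.mem_image.1 hp
    exact hxu C
  · exact accessible_iff_forall_isSSCC.2 fun C hC =>
      ⟨x ⟨C, hC⟩, hxC ⟨C, hC⟩, u ⟨C, hC⟩, Finset.mem_image_of_mem _ (Finset.mem_univ _)⟩
  · rw [Finset.card_image_of_injective, Finset.card_univ, ← Nat.card_eq_fintype_card,
      Nat.card_coe_set_eq]
    intro C D hCD
    have hx : x C = x D := congrArg Prod.fst hCD
    exact Subtype.ext <| by
      rw [C.2.eq_setOf_of_mem (hxC C), D.2.eq_setOf_of_mem (hxC D), hx]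

end

/-- If the digraph `r` has exactly `q` source strongly connected components and each
of them contains a vertex with an available input-connection, then the minimum
cardinality of an accessible subset of `E_B` is exactly `q`. -/
theorem sparsest_accessible_card_eq_num_ssccs {V U : Type*} [Fintype V] [Fintype U]
    (r : V → V → Prop) (E_B : Finset (V × U)) (q : ℕ)
    (hfin : {C : Set V | IsSSCC r C}.Finite)
    (hq : {C : Set V | IsSSCC r C}.ncard = q)
    (hcov : ∀ C : Set V, IsSSCC r C → ∃ v ∈ C, ∃ u : U, (v, u) ∈ E_B) :
    (∃ F ⊆ E_B, Accessible r F ∧ F.card = q) ∧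
      ∀ F' ⊆ E_B, Accessible r F' → q ≤ F'.card := by
  subst hq
  refine ⟨(accessible_iff_forall_isSSCC.2 hcov).exists_subset_card_eq, fun F' _ hF' => ?_⟩
  obtain ⟨G, hGF, -, hG⟩ := hF'.exists_subset_card_eq
  exact hG ▸ Finset.card_le_card hGF
end

section
/- Let V be a finite type, r : V → V → Prop a digraph, U a finite type of inputs, E_B : Finset (V × U), and w : V × U → ℝ with w e ≥ 0 for all e ∈ E_B. Suppose the set of source strongly connected components of r is finite with cardinality q and every source strongly connected component contains a vertex v with (v, u) ∈ E_B for some u. Then the minimum of ∑_{e ∈ F} w e over all accessible subsets F ⊆ E_B with |F| = q equals ∑_C min { w e | e ∈ E_B, e.1 ∈ C }, where the sum runs over all source strongly connected components C of r; moreover this minimum is attained by some accessible F ⊆ E_B with |F| = q. -/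
theorem IsSSCC.mem_of_reflTransGen {V : Type*} {r : V → V → Prop} {C : Set V} (hC : IsSSCC r C)
    {x y : V} (hy : y ∈ C) (hxy : Relation.ReflTransGen r x y) : x ∈ C := by
  obtain ⟨v, rfl, hv⟩ := hC
  exact ⟨hxy.trans hy.1, hv x (hxy.trans hy.1)⟩

theorem IsSSCC.reflTransGen {V : Type*} {r : V → V → Prop} {C : Set V} (hC : IsSSCC r C)
    {x y : V} (hx : x ∈ C) (hy : y ∈ C) : Relation.ReflTransGen r x y := by
  obtain ⟨v, rfl, -⟩ := hC
  exact hx.1.trans hy.2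

theorem IsSSCC.nonempty {V : Type*} {r : V → V → Prop} {C : Set V} (hC : IsSSCC r C) :
    C.Nonempty := by
  obtain ⟨v, rfl, -⟩ := hC
  exact ⟨v, .refl, .refl⟩

theorem IsSSCC.eq_of_mem {V : Type*} {r : V → V → Prop} {C D : Set V} (hC : IsSSCC r C)
    (hD : IsSSCC r D) {x : V} (hxC : x ∈ C) (hxD : x ∈ D) : C = D :=
  Set.Subset.antisymm (fun _ hy => hD.mem_of_reflTransGen hxD (hC.reflTransGen hy hxC))
    (fun _ hy => hC.mem_of_reflTransGen hxC (hD.reflTransGen hy hxD))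

/-- In a finite digraph every vertex is reachable from some source component. -/
theorem exists_isSSCC_reflTransGen {V : Type*} [Finite V] (r : V → V → Prop) (v : V) :
    ∃ C, IsSSCC r C ∧ ∃ x ∈ C, Relation.ReflTransGen r x v := by
  let _ : Preorder V :=
    { le := Relation.ReflTransGen r
      le_refl := fun _ => .refl
      le_trans := fun _ _ _ => .trans }
  obtain ⟨m, hmv, hm⟩ :=
    (Set.toFinite (Set.univ : Set V)).exists_le_minimal (Set.mem_univ v)
  exact ⟨_, ⟨m, rfl, fun u hu => hm.2 (Set.mem_univ u) hu⟩, m, ⟨.refl, .refl⟩, hmv⟩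

/-- A family of edges, one entering each source component, is injective. -/
theorem injective_of_fst_mem_isSSCC {V U : Type*} {r : V → V → Prop} {s : Finset (Set V)}
    (hs : ∀ C ∈ s, IsSSCC r C) {f : s → V × U} (hf : ∀ C, (f C).1 ∈ C.1) :
    Function.Injective f := fun C D h =>
  Subtype.ext ((hs C C.2).eq_of_mem (hs D D.2) (hf C) (h ▸ hf D))

theorem finite_setOf_cost {V U : Type*} (E : Finset (V × U)) (w : V × U → ℝ) (C : Set V) :
    {x : ℝ | ∃ e ∈ E, e.1 ∈ C ∧ w e = x}.Finite :=
  (E.finite_toSet.image w).subset fun _ ⟨e, he, _, hx⟩ => ⟨e, he, hx⟩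

/-- The minimum cost of an accessible subset of `E_B` of minimum cardinality `q`
equals the sum, over all source strongly connected components `C`, of the cheapest
available input-connection entering `C`; moreover this minimum is attained. -/
theorem min_cost_sparsest_accessible_eq_sum_of_min {V U : Type*} [Fintype V] [Fintype U]
    (r : V → V → Prop) (E_B : Finset (V × U)) (w : V × U → ℝ)
    (hw : ∀ e ∈ E_B, 0 ≤ w e) (q : ℕ)
    (hfin : {C : Set V | IsSSCC r C}.Finite)
    (hq : {C : Set V | IsSSCC r C}.ncard = q)
    (hcov : ∀ C : Set V, IsSSCC r C → ∃ v ∈ C, ∃ u : U, (v, u) ∈ E_B) :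
    (∃ F ⊆ E_B, Accessible r F ∧ F.card = q ∧
        ∑ e ∈ F, w e =
          ∑ C ∈ hfin.toFinset, sInf {x : ℝ | ∃ e ∈ E_B, e.1 ∈ C ∧ w e = x}) ∧
      ∀ F ⊆ E_B, Accessible r F → F.card = q →
        ∑ C ∈ hfin.toFinset, sInf {x : ℝ | ∃ e ∈ E_B, e.1 ∈ C ∧ w e = x} ≤
          ∑ e ∈ F, w e := by
  classical
  have hs : ∀ C ∈ hfin.toFinset, IsSSCC r C := fun C hC => by simpa using hC
  constructor
  · have hmin (C : hfin.toFinset) : ∃ e ∈ E_B, e.1 ∈ C.1 ∧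
        w e = sInf {x : ℝ | ∃ e ∈ E_B, e.1 ∈ C.1 ∧ w e = x} := by
      obtain ⟨v, hv, u, hu⟩ := hcov C (hs C C.2)
      have hne : {x : ℝ | ∃ e ∈ E_B, e.1 ∈ C.1 ∧ w e = x}.Nonempty :=
        ⟨w (v, u), (v, u), hu, hv, rfl⟩
      exact hne.csInf_mem (finite_setOf_cost E_B w C)
    choose f hfE hfC hfw using hmin
    have hinj := injective_of_fst_mem_isSSCC hs hfC
    refine ⟨Finset.univ.image f, ?_, ?_, ?_, ?_⟩
    · exact Finset.image_subset_iff.2 fun C _ => hfE C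
    · intro v
      obtain ⟨C, hC, x, hx, hxv⟩ := exists_isSSCC_reflTransGen r v
      let C' : hfin.toFinset := ⟨C, by simpa using hC⟩
      exact ⟨(f C').1, ⟨(f C').2, Finset.mem_image_of_mem f (Finset.mem_univ C')⟩,
        (hC.reflTransGen (hfC C') hx).trans hxv⟩
    · rw [Finset.card_image_of_injective _ hinj, Finset.card_univ, Fintype.card_coe, ← hq,
        Set.ncard_eq_toFinset_card _ hfin]
    · rw [Finset.sum_image hinj.injOn, ← Finset.sum_coe_sort hfin.toFinset]
      exact Finset.sum_congr rfl fun C _ => hfw C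
  · intro F hFE hF _
    have hhit (C : hfin.toFinset) : ∃ e ∈ F, e.1 ∈ C.1 := by
      obtain ⟨v, hv⟩ := (hs C C.2).nonempty
      obtain ⟨x, ⟨u, hu⟩, hxv⟩ := hF v
      exact ⟨(x, u), hu, (hs C C.2).mem_of_reflTransGen hv hxv⟩
    choose f hfF hfC using hhit
    have hinj := injective_of_fst_mem_isSSCC hs hfC
    rw [← Finset.sum_coe_sort hfin.toFinset]
    calc _ ≤ ∑ C, w (f C) := Finset.sum_le_sum fun C _ =>
          csInf_le (finite_setOf_cost E_B w C).bddBelow ⟨f C, hFE (hfF C), hfC C, rfl⟩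
      _ = ∑ e ∈ Finset.univ.image f, w e := (Finset.sum_image hinj.injOn).symm
      _ ≤ ∑ e ∈ F, w e := Finset.sum_le_sum_of_subset_of_nonneg
          (Finset.image_subset_iff.2 fun C _ => hfF C) fun e he _ => hw e (hFE he)
end

section
/- Let α, β, γ be finite types, E_A : Finset (α × β), E_B : Finset (γ × β), and w : γ × β → ℝ with w e > 0 for all e ∈ E_B. If (M_A, M_B) is a saturating matching for (E_A, E_B) whose B-cost ∑_{e ∈ M_B} w e is minimal among all saturating matchings for (E_A, E_B), then M_A is a maximum matching of E_A; that is, every finset N ⊆ E_A on which both Prod.fst and Prod.snd are injective satisfies |N| ≤ |M_A|. -/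
/-- A saturating matching for the pair of bipartite edge sets `(E_A, E_B)`
(state-edges `E_A : Finset (α × β)`, input-edges `E_B : Finset (γ × β)`):
a pair `(MA, MB)` of matchings contained in `E_A` and `E_B` respectively,
using each right vertex `b : β` at most once overall, and saturating every
`b : β`. -/
def SatMatching {α β γ : Type*} (E_A : Finset (α × β)) (E_B : Finset (γ × β))
    (MA : Finset (α × β)) (MB : Finset (γ × β)) : Prop :=
  MA ⊆ E_A ∧ MB ⊆ E_B ∧
  Set.InjOn Prod.fst (MA : Set (α × β)) ∧ Set.InjOn Prod.snd (MA : Set (α × β)) ∧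
  Set.InjOn Prod.fst (MB : Set (γ × β)) ∧ Set.InjOn Prod.snd (MB : Set (γ × β)) ∧
  (∀ b : β, ¬((∃ e ∈ MA, e.2 = b) ∧ (∃ e ∈ MB, e.2 = b))) ∧
  (∀ b : β, (∃ e ∈ MA, e.2 = b) ∨ (∃ e ∈ MB, e.2 = b))

open Classical in
/-- Augmentation for matchings of a bipartite graph: if `N` is a larger matching than `M`, then the
right vertices saturated by `M` form a proper subset of those saturated by some matching. -/
theorem exists_matching_image_snd_ssubset {α β : Type*} {E M N : Finset (α × β)}
    (hME : M ⊆ E) (hNE : N ⊆ E)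
    (hM₁ : Set.InjOn Prod.fst (M : Set (α × β))) (hM₂ : Set.InjOn Prod.snd (M : Set (α × β)))
    (hN₁ : Set.InjOn Prod.fst (N : Set (α × β))) (hN₂ : Set.InjOn Prod.snd (N : Set (α × β)))
    (hcard : M.card < N.card) :
    ∃ M' ⊆ E, Set.InjOn Prod.fst (M' : Set (α × β)) ∧ Set.InjOn Prod.snd (M' : Set (α × β)) ∧
      M.image Prod.snd ⊂ M'.image Prod.snd := by
  induction hn : (N \ M).card using Nat.strong_induction_on generalizing M with
  | _ n ih =>
  obtain ⟨e, heN, he⟩ : ∃ e ∈ N, e.1 ∉ M.image Prod.fst := by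
    by_contra! h
    have := Finset.card_le_card (Finset.image_subset_iff.2 h)
    rw [Finset.card_image_of_injOn hN₁, Finset.card_image_of_injOn hM₁] at this
    omega
  have heM : e ∉ M := fun h => he (Finset.mem_image_of_mem _ h)
  by_cases hb : e.2 ∈ M.image Prod.snd
  · obtain ⟨f, hfM, hfe⟩ := Finset.mem_image.1 hb
    have hfN : f ∉ N := fun h => heM (hN₂ h heN hfe ▸ hfM)
    have himage : (insert e (M.erase f)).image Prod.snd = M.image Prod.snd := by
      rw [Finset.image_insert, ← hfe, ← Finset.image_insert, Finset.insert_erase hfM]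
    have hlt : (N \ insert e (M.erase f)).card < n := by
      rw [← hn]
      refine Finset.card_lt_card (Finset.ssubset_iff_subset_ne.2 ⟨fun x hx => ?_, fun h => ?_⟩)
      · grind
      · have : e ∈ N \ M := by grind
        rw [← h] at this
        grind
    have heMf : e ∉ (M.erase f : Set (α × β)) := fun h => heM (Finset.mem_of_mem_erase h)
    have herase : (M.erase f : Set (α × β)) ⊆ M := by exact_mod_cast M.erase_subset f
    rw [← himage]
    refine ih _ hlt ?_ ?_ ?_ ?_ rfl
    · exact Finset.insert_subset (hNE heN) ((M.erase_subset f).trans hME)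
    · rw [Finset.coe_insert, Set.injOn_insert heMf]
      refine ⟨hM₁.mono herase, ?_⟩
      rintro ⟨x, hx, hxe⟩
      exact he (Finset.mem_image.2 ⟨x, herase hx, hxe⟩)
    · rw [Finset.coe_insert, Set.injOn_insert heMf]
      refine ⟨hM₂.mono herase, ?_⟩
      rintro ⟨x, hx, hxe⟩
      exact Finset.ne_of_mem_erase hx (hM₂ (herase hx) hfM (hxe.trans hfe.symm))
    · rwa [Finset.card_insert_of_notMem heMf, Finset.card_erase_add_one hfM]
  · refine ⟨insert e M, Finset.insert_subset (hNE heN) hME, ?_, ?_, ?_⟩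
    · rw [Finset.coe_insert, Set.injOn_insert (by exact_mod_cast heM)]
      exact ⟨hM₁, fun h => he (by exact_mod_cast h)⟩
    · rw [Finset.coe_insert, Set.injOn_insert (by exact_mod_cast heM)]
      exact ⟨hM₂, fun h => hb (by exact_mod_cast h)⟩
    · rw [Finset.image_insert]
      exact Finset.ssubset_insert hb

/-- With strictly positive input-connection costs, the `A`-part of a minimum
`B`-cost saturating matching is a maximum matching of `E_A`. -/
theorem min_cost_sat_matching_A_part_maximum {α β γ : Type*}
    [Fintype α] [Fintype β] [Fintype γ]
    (E_A : Finset (α × β)) (E_B : Finset (γ × β)) (w : γ × β → ℝ)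
    (hw : ∀ e ∈ E_B, 0 < w e)
    (MA : Finset (α × β)) (MB : Finset (γ × β))
    (hM : SatMatching E_A E_B MA MB)
    (hmin : ∀ NA NB, SatMatching E_A E_B NA NB → ∑ e ∈ MB, w e ≤ ∑ e ∈ NB, w e) :
    ∀ N ⊆ E_A, Set.InjOn Prod.fst (N : Set (α × β)) →
      Set.InjOn Prod.snd (N : Set (α × β)) → N.card ≤ MA.card := by
  classical
  obtain ⟨hMA, hMB, hA₁, hA₂, hB₁, hB₂, hdisj, hcover⟩ := hM
  intro N hN hN₁ hN₂
  by_contra! hcard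
  obtain ⟨M', hM', hM'₁, hM'₂, hss⟩ :=
    exists_matching_image_snd_ssubset hMA hN hA₁ hA₂ hN₁ hN₂ hcard
  set NB := MB.filter fun e => e.2 ∉ M'.image Prod.snd
  have hsub : NB ⊆ MB := Finset.filter_subset _ _
  have hsat : SatMatching E_A E_B M' NB := by
    refine ⟨hM', hsub.trans hMB, hM'₁, hM'₂, hB₁.mono (by exact_mod_cast hsub),
      hB₂.mono (by exact_mod_cast hsub), ?_, fun b => ?_⟩
    · grind
    · by_cases hb : b ∈ M'.image Prod.snd
      · exact Or.inl (Finset.mem_image.1 hb)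
      · obtain h | ⟨e, he, rfl⟩ := hcover b
        · exact absurd (hss.1 (Finset.mem_image.2 h)) hb
        · exact Or.inr ⟨e, Finset.mem_filter.2 ⟨he, hb⟩, rfl⟩
  obtain ⟨b, hbM', hbM⟩ := Finset.exists_of_ssubset hss
  obtain ⟨e, he, rfl⟩ := (hcover b).resolve_left fun h => hbM (Finset.mem_image.2 h)
  refine (hmin M' NB hsat).not_gt
    (Finset.sum_lt_sum_of_subset hsub he (fun h => (Finset.mem_filter.1 h).2 hbM')
      (hw e (hMB he)) fun f hf _ => (hw f (hMB hf)).le)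
end

section
/- Let α, β, γ be finite types, E_A : Finset (α × β), E_B : Finset (γ × β), and w : γ × β → ℝ with w e > 0 for all e ∈ E_B. If (M_A, M_B) is a saturating matching for (E_A, E_B) whose B-cost ∑_{e ∈ M_B} w e is minimal among all saturating matchings for (E_A, E_B), then M_B also has minimum cardinality: every saturating matching (N_A, N_B) for (E_A, E_B) satisfies |N_B| ≥ |M_B|. -/
open Classical in
/-- Augmentation property of bipartite matchings: a matching smaller than another one can be
rerouted so as to cover exactly one additional right vertex. -/
theorem exists_matching_image_snd_eq_insert {α β : Type*} {E N : Finset (α × β)} (hNE : N ⊆ E)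
    (hN₁ : Set.InjOn Prod.fst (N : Set (α × β))) (hN₂ : Set.InjOn Prod.snd (N : Set (α × β)))
    (M : Finset (α × β)) (hME : M ⊆ E)
    (hM₁ : Set.InjOn Prod.fst (M : Set (α × β))) (hM₂ : Set.InjOn Prod.snd (M : Set (α × β)))
    (hcard : M.card < N.card) :
    ∃ M' ⊆ E, Set.InjOn Prod.fst (M' : Set (α × β)) ∧ Set.InjOn Prod.snd (M' : Set (α × β)) ∧
      ∃ b ∉ M.image Prod.snd, M'.image Prod.snd = insert b (M.image Prod.snd) := by
  obtain ⟨a, haN, haM⟩ : ∃ a ∈ N.image Prod.fst, a ∉ M.image Prod.fst := by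
    apply Finset.exists_mem_notMem_of_card_lt_card
    rwa [Finset.card_image_of_injOn hM₁, Finset.card_image_of_injOn hN₁]
  obtain ⟨⟨a, b⟩, hab, rfl⟩ := Finset.mem_image.1 haN
  have ha : ∀ e ∈ M, e.1 ≠ a := fun e he h => haM (Finset.mem_image.2 ⟨e, he, h⟩)
  by_cases hb : b ∈ M.image Prod.snd
  · obtain ⟨e, he, heb⟩ := Finset.mem_image.1 hb
    have heN : e ∉ N := fun h => ha e he (congrArg Prod.fst (hN₂ h hab heb))
    have habM : (a, b) ∉ M := fun h => ha _ h rfl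
    have himage : (insert (a, b) (M.erase e)).image Prod.snd = M.image Prod.snd := by
      conv_rhs => rw [← Finset.insert_erase he, Finset.image_insert, heb]
      rw [Finset.image_insert]
    have hlt : (N \ insert (a, b) (M.erase e)).card < (N \ M).card := by
      apply Finset.card_lt_card
      rw [Finset.ssubset_iff_of_subset]
      · exact ⟨(a, b), by simp [hab, habM], by simp⟩
      · intro x hx
        simp only [Finset.mem_sdiff, Finset.mem_insert, Finset.mem_erase] at hx ⊢
        grind
    rw [← himage]
    refine exists_matching_image_snd_eq_insert hNE hN₁ hN₂ _ ?_ ?_ ?_ ?_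
    · exact Finset.insert_subset (hNE hab) ((Finset.erase_subset _ _).trans hME)
    · intro x hx y hy hxy
      have := @hM₁ x
      simp only [Finset.coe_insert, Finset.coe_erase, Set.mem_insert_iff, Set.mem_sdiff,
        Finset.mem_coe] at hx hy this
      grind
    · intro x hx y hy hxy
      have := @hM₂
      simp only [Set.InjOn, Finset.coe_insert, Finset.coe_erase, Set.mem_insert_iff,
        Set.mem_sdiff, Set.mem_singleton_iff, Finset.mem_coe] at hx hy this
      grind
    · rwa [Finset.card_insert_of_notMem (fun h => habM (Finset.mem_of_mem_erase h)),
        Finset.card_erase_add_one he]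
  · have hb' : ∀ e ∈ M, e.2 ≠ b := fun e he h => hb (Finset.mem_image.2 ⟨e, he, h⟩)
    refine ⟨insert (a, b) M, Finset.insert_subset (hNE hab) hME, ?_, ?_, b, hb,
      Finset.image_insert _ _ _⟩
    · rw [Finset.coe_insert, Set.injOn_insert (fun h => ha _ h rfl)]
      exact ⟨hM₁, fun ⟨e, he, h⟩ => ha e he h⟩
    · rw [Finset.coe_insert, Set.injOn_insert (fun h => ha _ h rfl)]
      exact ⟨hM₂, fun ⟨e, he, h⟩ => hb' e he h⟩
termination_by (N \ M).card

theorem SatMatching.card_add_card {α β γ : Type*} [Fintype β]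
    {E_A : Finset (α × β)} {E_B : Finset (γ × β)} {MA : Finset (α × β)} {MB : Finset (γ × β)}
    (h : SatMatching E_A E_B MA MB) : MA.card + MB.card = Fintype.card β := by
  classical
  obtain ⟨-, -, -, hA, -, hB, hdisj, hcover⟩ := h
  rw [← Finset.card_image_of_injOn hA, ← Finset.card_image_of_injOn hB,
    ← Finset.card_union_of_disjoint, ← Finset.card_univ]
  · congr 1
    ext b
    simpa only [Finset.mem_union, Finset.mem_image, Finset.mem_univ, iff_true] using hcover b
  · rw [Finset.disjoint_left]
    intro b hb hb'
    exact hdisj b ⟨Finset.mem_image.1 hb, Finset.mem_image.1 hb'⟩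

/-- With strictly positive input-connection costs, a minimum `B`-cost saturating
matching also has a `B`-part of minimum cardinality. -/
theorem min_cost_sat_matching_B_part_sparsest {α β γ : Type*}
    [Fintype α] [Fintype β] [Fintype γ]
    (E_A : Finset (α × β)) (E_B : Finset (γ × β)) (w : γ × β → ℝ)
    (hw : ∀ e ∈ E_B, 0 < w e)
    (MA : Finset (α × β)) (MB : Finset (γ × β))
    (hM : SatMatching E_A E_B MA MB)
    (hmin : ∀ NA NB, SatMatching E_A E_B NA NB → ∑ e ∈ MB, w e ≤ ∑ e ∈ NB, w e) :
    ∀ NA NB, SatMatching E_A E_B NA NB → MB.card ≤ NB.card := by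
  classical
  intro NA NB hN
  by_contra! hlt
  have hMcard := hM.card_add_card
  have hNcard := hN.card_add_card
  obtain ⟨hMA, hMB, hA₁, hA₂, hB₁, hB₂, hdisj, hcover⟩ := hM
  obtain ⟨hNA, -, hN₁, hN₂, -⟩ := hN
  obtain ⟨M', hM', hM'₁, hM'₂, b, hb, himage⟩ :=
    exists_matching_image_snd_eq_insert hNA hN₁ hN₂ MA hMA hA₁ hA₂ (by omega)
  have hmem : ∀ c, (∃ e ∈ M', e.2 = c) ↔ c = b ∨ ∃ e ∈ MA, e.2 = c := fun c => by
    rw [← Finset.mem_image, himage, Finset.mem_insert, Finset.mem_image]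
  obtain ⟨f, hf, hfb⟩ := (hcover b).resolve_left fun h => hb (Finset.mem_image.2 h)
  have hsub : (MB.erase f : Set (γ × β)) ⊆ MB := Finset.coe_subset.2 (Finset.erase_subset f MB)
  have hle := hmin M' (MB.erase f) ⟨hM', (Finset.erase_subset f MB).trans hMB, hM'₁, hM'₂,
    hB₁.mono hsub, hB₂.mono hsub, fun c => ?_, fun c => ?_⟩
  · rw [← Finset.add_sum_erase MB w hf] at hle
    linarith [hw f (hMB hf)]
  · rw [hmem]
    rintro ⟨hc | hc, e, he, hec⟩
    · exact Finset.ne_of_mem_erase he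
        (hB₂ (Finset.mem_of_mem_erase he) hf (hec.trans (hc.trans hfb.symm)))
    · exact hdisj c ⟨hc, e, Finset.mem_of_mem_erase he, hec⟩
  · rw [hmem]
    by_cases hc : c = b
    · exact Or.inl (Or.inl hc)
    · refine (hcover c).imp Or.inr fun ⟨e, he, hec⟩ => ⟨e, Finset.mem_erase.2 ⟨?_, he⟩, hec⟩
      rintro rfl
      exact hc (hec.symm.trans hfb)
end

section
/- Let α, β, γ be finite types, E_A : Finset (α × β), E_B : Finset (γ × β), and w : γ × β → ℝ with w e ≥ 0 for all e ∈ E_B. Suppose there exists at least one saturating matching for (E_A, E_B). If (M_A, M_B) is a saturating matching minimizing the modified B-cost ∑_{e ∈ M_B} (w e + 1) among all saturating matchings for (E_A, E_B), then (M_A, M_B) also minimizes the B-cost ∑_{e ∈ M_B} w e among all saturating matchings for (E_A, E_B). -/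
/-- Given two matchings `N`, `M` of a bipartite graph `E`, there is a matching of `E` that is at least
as large as `M` and covers every right vertex covered by `N`. -/
theorem exists_matching_covering_card_le {α β : Type*} {E N M : Finset (α × β)}
    (hNE : N ⊆ E) (hN₁ : Set.InjOn Prod.fst (N : Set (α × β)))
    (hN₂ : Set.InjOn Prod.snd (N : Set (α × β)))
    (hME : M ⊆ E) (hM₁ : Set.InjOn Prod.fst (M : Set (α × β)))
    (hM₂ : Set.InjOn Prod.snd (M : Set (α × β))) :
    ∃ K ⊆ E, Set.InjOn Prod.fst (K : Set (α × β)) ∧ Set.InjOn Prod.snd (K : Set (α × β)) ∧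
      (∀ e ∈ N, ∃ k ∈ K, k.2 = e.2) ∧ M.card ≤ K.card := by
  classical
  let S := E.powerset.filter fun K : Finset (α × β) =>
    Set.InjOn Prod.fst (K : Set (α × β)) ∧ Set.InjOn Prod.snd (K : Set (α × β)) ∧
      ∀ e ∈ N, ∃ k ∈ K, k.2 = e.2
  have hNS : N ∈ S := by
    simp only [S, Finset.mem_filter, Finset.mem_powerset]
    exact ⟨hNE, hN₁, hN₂, fun e he => ⟨e, he, rfl⟩⟩
  obtain ⟨K, hKS, hmax⟩ := S.exists_max_image (fun K : Finset (α × β) => K.card + (K ∩ M).card) ⟨N, hNS⟩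
  simp only [S, Finset.mem_filter, Finset.mem_powerset] at hKS hmax
  obtain ⟨hKE, hK₁, hK₂, hKN⟩ := hKS
  refine ⟨K, hKE, hK₁, hK₂, hKN, ?_⟩
  by_contra! hlt
  rw [← Finset.card_image_of_injOn hK₁, ← Finset.card_image_of_injOn hM₁] at hlt
  obtain ⟨a, haM, haK⟩ := Finset.exists_mem_notMem_of_card_lt_card hlt
  obtain ⟨e, heM, rfl⟩ := Finset.mem_image.1 haM
  have hfst : ∀ k ∈ K, k.1 ≠ e.1 := fun k hk h => haK (Finset.mem_image.2 ⟨k, hk, h⟩)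
  have heK : e ∉ K := fun h => hfst e h rfl
  by_cases hb : ∃ k ∈ K, k.2 = e.2
  · obtain ⟨k, hk, hke⟩ := hb
    have hkM : k ∉ M := fun h => heK (hM₂ h heM hke ▸ hk)
    have heK' : e ∉ K.erase k := fun h => heK (Finset.mem_of_mem_erase h)
    have hKsub : ((K.erase k : Finset (α × β)) : Set (α × β)) ⊆ K :=
      Finset.coe_subset.2 (Finset.erase_subset k K)
    have h := hmax (insert e (K.erase k)) ⟨?_, ?_, ?_, ?_⟩
    · rw [Finset.insert_inter_of_mem heM, Finset.erase_inter,
        Finset.erase_eq_of_notMem fun h => hkM (Finset.mem_inter.1 h).2,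
        Finset.card_insert_of_notMem fun h => heK (Finset.mem_inter.1 h).1,
        Finset.card_insert_of_notMem heK', Finset.card_erase_add_one hk] at h
      omega
    · exact Finset.insert_subset (hME heM) ((Finset.erase_subset k K).trans hKE)
    · rw [Finset.coe_insert, Set.injOn_insert (mt Finset.mem_coe.1 heK')]
      exact ⟨hK₁.mono hKsub, fun ⟨x, hx, hxe⟩ => hfst x (hKsub hx) hxe⟩
    · rw [Finset.coe_insert, Set.injOn_insert (mt Finset.mem_coe.1 heK')]
      refine ⟨hK₂.mono hKsub, fun ⟨x, hx, hxe⟩ => ?_⟩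
      exact (Finset.mem_erase.1 (Finset.mem_coe.1 hx)).1
        (hK₂ (hKsub hx) (Finset.mem_coe.2 hk) (hxe.trans hke.symm))
    · intro x hx
      obtain ⟨y, hy, hyx⟩ := hKN x hx
      by_cases hyk : y = k
      · exact ⟨e, Finset.mem_insert_self _ _, by rw [← hke, ← hyk, hyx]⟩
      · exact ⟨y, Finset.mem_insert_of_mem (Finset.mem_erase.2 ⟨hyk, hy⟩), hyx⟩
  · have h := hmax (insert e K) ⟨?_, ?_, ?_, ?_⟩
    · rw [Finset.insert_inter_of_mem heM, Finset.card_insert_of_notMem heK,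
        Finset.card_insert_of_notMem fun h => heK (Finset.mem_inter.1 h).1] at h
      omega
    · exact Finset.insert_subset (hME heM) hKE
    · rw [Finset.coe_insert, Set.injOn_insert (mt Finset.mem_coe.1 heK)]
      exact ⟨hK₁, fun ⟨x, hx, hxe⟩ => hfst x hx hxe⟩
    · rw [Finset.coe_insert, Set.injOn_insert (mt Finset.mem_coe.1 heK)]
      exact ⟨hK₂, fun ⟨x, hx, hxe⟩ => hb ⟨x, hx, hxe⟩⟩
    · intro x hx
      obtain ⟨y, hy, hyx⟩ := hKN x hx
      exact ⟨y, Finset.mem_insert_of_mem hy, hyx⟩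

/-- The input edges of a saturating matching can be thinned out until there are at most as many as
in any other given saturating matching. -/
theorem SatMatching.exists_subset_card_le {α β γ : Type*} [Fintype β]
    {E_A : Finset (α × β)} {E_B : Finset (γ × β)} {MA NA : Finset (α × β)}
    {MB NB : Finset (γ × β)} (hM : SatMatching E_A E_B MA MB) (hN : SatMatching E_A E_B NA NB) :
    ∃ KA, ∃ KB ⊆ NB, SatMatching E_A E_B KA KB ∧ KB.card ≤ MB.card := by
  classical
  obtain ⟨hNA, hNB, hA₁, hA₂, hB₁, hB₂, -, hcov⟩ := hN
  obtain ⟨KA, hKA, hK₁, hK₂, hKN, hcard⟩ :=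
    exists_matching_covering_card_le hNA hA₁ hA₂ hM.1 hM.2.2.1 hM.2.2.2.1
  let KB := NB.filter fun e => ¬∃ k ∈ KA, k.2 = e.2
  have hsub : KB ⊆ NB := Finset.filter_subset _ _
  have hK : SatMatching E_A E_B KA KB := by
    refine ⟨hKA, hsub.trans hNB, hK₁, hK₂, hB₁.mono (Finset.coe_subset.2 hsub),
      hB₂.mono (Finset.coe_subset.2 hsub), ?_, ?_⟩
    · rintro b ⟨hb, e, he, rfl⟩
      exact (Finset.mem_filter.1 he).2 hb
    · intro b
      by_cases hb : ∃ k ∈ KA, k.2 = b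
      · exact Or.inl hb
      · rcases hcov b with ⟨e, he, rfl⟩ | ⟨e, he, rfl⟩
        · exact absurd (hKN e he) hb
        · exact Or.inr ⟨e, Finset.mem_filter.2 ⟨he, hb⟩, rfl⟩
  refine ⟨KA, KB, hsub, hK, ?_⟩
  have h₁ := hM.card_add_card
  have h₂ := hK.card_add_card
  omega

/-- A saturating matching minimizing the shifted `B`-cost `∑ (w e + 1)` also
minimizes the original `B`-cost `∑ w e`. -/
theorem min_shifted_cost_sat_matching_min_cost {α β γ : Type*}
    [Fintype α] [Fintype β] [Fintype γ]
    (E_A : Finset (α × β)) (E_B : Finset (γ × β)) (w : γ × β → ℝ)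
    (hw : ∀ e ∈ E_B, 0 ≤ w e)
    (hex : ∃ MA MB, SatMatching E_A E_B MA MB)
    (MA : Finset (α × β)) (MB : Finset (γ × β))
    (hM : SatMatching E_A E_B MA MB)
    (hmin : ∀ NA NB, SatMatching E_A E_B NA NB →
      ∑ e ∈ MB, (w e + 1) ≤ ∑ e ∈ NB, (w e + 1)) :
    ∀ NA NB, SatMatching E_A E_B NA NB → ∑ e ∈ MB, w e ≤ ∑ e ∈ NB, w e := by
  intro NA NB hN
  obtain ⟨KA, KB, hsub, hK, hcard⟩ := hM.exists_subset_card_le hN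
  have h := hmin KA KB hK
  simp only [Finset.sum_add_distrib, Finset.sum_const, nsmul_eq_mul, mul_one] at h
  have hle : ∑ e ∈ KB, w e ≤ ∑ e ∈ NB, w e :=
    Finset.sum_le_sum_of_subset_of_nonneg hsub fun e he _ => hw e (hN.2.1 he)
  have hcard' : (KB.card : ℝ) ≤ MB.card := by exact_mod_cast hcard
  linarith
end

section
/- Let α, β, γ be finite types, E_A : Finset (α × β), E_B : Finset (γ × β), and w : γ × β → ℝ with w e ≥ 0 for all e ∈ E_B. Suppose there exists at least one saturating matching for (E_A, E_B). If (M_A, M_B) is a saturating matching minimizing the modified B-cost ∑_{e ∈ M_B} (w e + 1) among all saturating matchings for (E_A, E_B), then every saturating matching (N_A, N_B) for (E_A, E_B) satisfies |N_B| ≥ |M_B|; consequently (M_A, M_B) minimizes the B-cost ∑_{e ∈ M_B} w e among all saturating matchings whose B-part has minimum cardinality. -/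
/-- Augmentation property of bipartite matchings: if `M` and `N` are matchings in `E` and
`M` is smaller than `N`, then some matching in `E` covers exactly the right vertices of `M`
and one further right vertex. -/
theorem exists_matching_covering_one_more {α β : Type*} (E M N : Finset (α × β))
    (hME : M ⊆ E) (hM₁ : Set.InjOn Prod.fst (M : Set (α × β)))
    (hM₂ : Set.InjOn Prod.snd (M : Set (α × β)))
    (hNE : N ⊆ E) (hN₁ : Set.InjOn Prod.fst (N : Set (α × β)))
    (hN₂ : Set.InjOn Prod.snd (N : Set (α × β)))
    (hcard : M.card < N.card) :
    ∃ M' : Finset (α × β), M' ⊆ E ∧ Set.InjOn Prod.fst (M' : Set (α × β)) ∧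
      Set.InjOn Prod.snd (M' : Set (α × β)) ∧
      ∃ b, (∀ e ∈ M, e.2 ≠ b) ∧
        ∀ c, (∃ e ∈ M', e.2 = c) ↔ c = b ∨ ∃ e ∈ M, e.2 = c := by
  classical
  induction h : (N \ M).card using Nat.strong_induction_on generalizing M with
  | _ n ih =>
  have hfst : (M.image Prod.fst).card < (N.image Prod.fst).card := by
    rwa [Finset.card_image_of_injOn hM₁, Finset.card_image_of_injOn hN₁]
  obtain ⟨a, haN, haM⟩ := Finset.exists_mem_notMem_of_card_lt_card hfst
  obtain ⟨⟨a, b⟩, hab, rfl⟩ := Finset.mem_image.mp haN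
  have ha : ∀ e ∈ M, e.1 ≠ a := fun e he hea => haM (Finset.mem_image.mpr ⟨e, he, hea⟩)
  by_cases hb : ∃ e ∈ M, e.2 = b
  · obtain ⟨e, he, heb⟩ := hb
    have heN : e ∉ N := fun h' => ha e he (congrArg Prod.fst (hN₂ h' hab heb))
    have habM : (a, b) ∉ M := fun h' => ha _ h' rfl
    have hsub : N \ insert (a, b) (M.erase e) ⊂ N \ M := by
      refine Finset.ssubset_iff_of_subset (fun x hx => ?_) |>.mpr
        ⟨(a, b), by simp [hab, habM], by simp⟩
      simp only [Finset.mem_sdiff, Finset.mem_insert, Finset.mem_erase] at hx ⊢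
      refine ⟨hx.1, fun hxM => hx.2 (Or.inr ⟨?_, hxM⟩)⟩
      rintro rfl
      exact heN hx.1
    obtain ⟨M', hM'E, hM'₁, hM'₂, c, hc, hM'⟩ :=
      ih _ (h ▸ Finset.card_lt_card hsub) (insert (a, b) (M.erase e))
        (Finset.insert_subset (hNE hab) ((Finset.erase_subset _ _).trans hME))
        (by
          intro x hx y hy hxy
          simp only [Finset.coe_insert, Finset.coe_erase, Set.mem_insert_iff, Set.mem_sdiff,
            Finset.mem_coe, Set.mem_singleton_iff] at hx hy
          rcases hx with rfl | hx <;> rcases hy with rfl | hy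
          · rfl
          · exact absurd hxy.symm (ha y hy.1)
          · exact absurd hxy (ha x hx.1)
          · exact hM₁ hx.1 hy.1 hxy)
        (by
          intro x hx y hy hxy
          simp only [Finset.coe_insert, Finset.coe_erase, Set.mem_insert_iff, Set.mem_sdiff,
            Finset.mem_coe, Set.mem_singleton_iff] at hx hy
          rcases hx with rfl | hx <;> rcases hy with rfl | hy
          · rfl
          · exact absurd (hM₂ hy.1 he (hxy.symm.trans heb.symm)) hy.2
          · exact absurd (hM₂ hx.1 he (hxy.trans heb.symm)) hx.2
          · exact hM₂ hx.1 hy.1 hxy)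
        (by
          rw [Finset.card_insert_of_notMem (fun h' => habM (Finset.mem_of_mem_erase h')),
            Finset.card_erase_add_one he]
          exact hcard) rfl
    have hcover : ∀ d, (∃ x ∈ insert (a, b) (M.erase e), x.2 = d) ↔ ∃ x ∈ M, x.2 = d := by
      intro d
      constructor
      · rintro ⟨x, hx, rfl⟩
        rcases Finset.mem_insert.mp hx with rfl | hx
        · exact ⟨e, he, heb⟩
        · exact ⟨x, Finset.mem_of_mem_erase hx, rfl⟩
      · rintro ⟨x, hx, rfl⟩
        by_cases hxe : x = e
        · exact ⟨(a, b), Finset.mem_insert_self _ _, by rw [hxe, heb]⟩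
        · exact ⟨x, Finset.mem_insert_of_mem (Finset.mem_erase.mpr ⟨hxe, hx⟩), rfl⟩
    refine ⟨M', hM'E, hM'₁, hM'₂, c, fun x hx hxc => ?_, fun d => by rw [hM', hcover]⟩
    obtain ⟨y, hy, hyc⟩ := (hcover c).mpr ⟨x, hx, hxc⟩
    exact hc y hy hyc
  · push Not at hb
    refine ⟨insert (a, b) M, Finset.insert_subset (hNE hab) hME, ?_, ?_, b, hb, ?_⟩
    · rw [Finset.coe_insert, Set.injOn_insert (fun h' => ha _ h' rfl)]
      exact ⟨hM₁, fun ⟨x, hx, hxa⟩ => ha x hx hxa⟩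
    · rw [Finset.coe_insert, Set.injOn_insert (fun h' => ha _ h' rfl)]
      exact ⟨hM₂, fun ⟨x, hx, hxb⟩ => hb x hx hxb⟩
    · intro c
      simp only [Finset.exists_mem_insert, eq_comm]

/-- A saturating matching whose state part is not of maximum size can be improved by dropping
one input edge. -/
theorem SatMatching.exists_erase {α β γ : Type*} [DecidableEq (γ × β)]
    {E_A : Finset (α × β)} {E_B : Finset (γ × β)} {MA NA : Finset (α × β)}
    {MB NB : Finset (γ × β)} (hM : SatMatching E_A E_B MA MB)
    (hN : SatMatching E_A E_B NA NB) (hcard : MA.card < NA.card) :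
    ∃ MA', ∃ f ∈ MB, SatMatching E_A E_B MA' (MB.erase f) := by
  obtain ⟨hMA, hMB, hA₁, hA₂, hB₁, hB₂, hdisj, hcov⟩ := hM
  obtain ⟨hNA, -, hNA₁, hNA₂, -⟩ := hN
  obtain ⟨MA', hE, h₁, h₂, b, hb, hMA'⟩ :=
    exists_matching_covering_one_more E_A MA NA hMA hA₁ hA₂ hNA hNA₁ hNA₂ hcard
  obtain ⟨f, hf, rfl⟩ := (hcov b).resolve_left fun ⟨e, he, heb⟩ => hb e he heb
  have hsub : (↑(MB.erase f) : Set (γ × β)) ⊆ MB := Finset.coe_subset.mpr (Finset.erase_subset _ _)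
  refine ⟨MA', f, hf, hE, (Finset.erase_subset _ _).trans hMB, h₁, h₂, hB₁.mono hsub,
    hB₂.mono hsub, ?_, ?_⟩
  · rintro c ⟨hc, e, he, rfl⟩
    have heMB := Finset.mem_of_mem_erase he
    rcases (hMA' _).mp hc with hef | hc
    · exact Finset.ne_of_mem_erase he (hB₂ heMB hf hef)
    · exact hdisj _ ⟨hc, e, heMB, rfl⟩
  · intro c
    rw [hMA']
    rcases hcov c with hc | ⟨e, he, rfl⟩
    · exact Or.inl (Or.inr hc)
    · by_cases hef : e = f
      · exact Or.inl (Or.inl (by rw [hef]))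
      · exact Or.inr ⟨e, Finset.mem_erase.mpr ⟨hef, he⟩, rfl⟩

/-- A saturating matching minimizing the shifted `B`-cost `∑ (w e + 1)` has a
`B`-part of minimum cardinality, and consequently minimizes the `B`-cost among all
saturating matchings whose `B`-part has minimum cardinality. -/
theorem min_shifted_cost_sat_matching_sparsest {α β γ : Type*}
    [Fintype α] [Fintype β] [Fintype γ]
    (E_A : Finset (α × β)) (E_B : Finset (γ × β)) (w : γ × β → ℝ)
    (hw : ∀ e ∈ E_B, 0 ≤ w e)
    (hex : ∃ MA MB, SatMatching E_A E_B MA MB)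
    (MA : Finset (α × β)) (MB : Finset (γ × β))
    (hM : SatMatching E_A E_B MA MB)
    (hmin : ∀ NA NB, SatMatching E_A E_B NA NB →
      ∑ e ∈ MB, (w e + 1) ≤ ∑ e ∈ NB, (w e + 1)) :
    (∀ NA NB, SatMatching E_A E_B NA NB → MB.card ≤ NB.card) ∧
    ∀ NA NB, SatMatching E_A E_B NA NB →
      (∀ PA PB, SatMatching E_A E_B PA PB → NB.card ≤ PB.card) →
      ∑ e ∈ MB, w e ≤ ∑ e ∈ NB, w e := by
  classical
  have hle : ∀ NA NB, SatMatching E_A E_B NA NB → MB.card ≤ NB.card := by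
    intro NA NB hN
    by_contra! hlt
    have hMcard := hM.card_add_card
    have hNcard := hN.card_add_card
    obtain ⟨MA', f, hf, hM'⟩ := hM.exists_erase hN (by omega)
    have hcost := hmin _ _ hM'
    rw [← Finset.add_sum_erase MB _ hf] at hcost
    linarith [hw f (hM.2.1 hf)]
  refine ⟨hle, fun NA NB hN hNmin => ?_⟩
  have hcard : MB.card = NB.card := (hle _ _ hN).antisymm (hNmin _ _ hM)
  have hcost := hmin _ _ hN
  simpa [Finset.sum_add_distrib, hcard] using hcost
end

section
/- Let V and γ be finite types, r : V → V → Prop a digraph, and ρ ∈ V a vertex such that there is no x with r x ρ and such that Relation.ReflTransGen r ρ v holds for every v ∈ V (i.e., r is a directed graph rooted at ρ). Set E_A : Finset (V × V) := the finset of pairs (u, v) with r u v, and let F : Finset (γ × V) be any set of input-edges. If (M_A, M_B) is a saturating matching for (E_A, F) (with β = V as the right side), then some (u, ρ) ∈ M_B, and consequently every vertex v ∈ V is reachable (via Relation.ReflTransGen r) from some vertex in {v | ∃ u, (u, v) ∈ F}. -/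
/-- For a directed graph rooted at `ρ` (no edge enters `ρ`, and `ρ` reaches every
vertex), any saturating matching for the bipartite graph of state-edges together
with input-edges `F` must use an input-edge into `ρ`, and consequently every
vertex is reachable from a vertex hit by `F`. -/
theorem rooted_tree_sat_matching_accessible {V γ : Type*}
    [Fintype V] [Fintype γ] [DecidableEq V]
    (r : V → V → Prop) [DecidableRel r] (ρ : V)
    (hnoin : ∀ x : V, ¬ r x ρ)
    (hroot : ∀ v : V, Relation.ReflTransGen r ρ v)
    (F : Finset (γ × V)) (MA : Finset (V × V)) (MB : Finset (γ × V))
    (hM : SatMatching (Finset.univ.filter fun p : V × V => r p.1 p.2) F MA MB) :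
    (∃ u : γ, (u, ρ) ∈ MB) ∧
      ∀ v : V, ∃ s : V, (∃ u : γ, (u, s) ∈ F) ∧ Relation.ReflTransGen r s v := by
  obtain ⟨hA, hB, -, -, -, -, -, hsat⟩ := hM
  have hρ : ∃ u : γ, (u, ρ) ∈ MB := by
    rcases hsat ρ with ⟨⟨x, _⟩, he, rfl⟩ | ⟨⟨u, _⟩, he, rfl⟩
    · exact absurd (Finset.mem_filter.mp (hA he)).2 (hnoin x)
    · exact ⟨u, he⟩
  obtain ⟨u, hu⟩ := hρ
  exact ⟨⟨u, hu⟩, fun v => ⟨ρ, ⟨u, hB hu⟩, hroot v⟩⟩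
end

section
/- Let V, U be finite types, r : V → V → Prop a digraph, E_B : Finset (V × U), and w : V × U → ℝ with w e ≥ 0 for all e ∈ E_B. Set E_A : Finset (V × V) := the finset of pairs (u, v) with r u v. Call F ⊆ E_B accessible if every vertex of V is reachable (via Relation.ReflTransGen r) from some vertex of {v | ∃ u, (v, u) ∈ F}, call F SDR-feasible if (E_A, {(u, v) | (v, u) ∈ F}) admits a saturating matching (with β = V as the right side), and call F feasible if it is both accessible and SDR-feasible. Suppose some F₀ ⊆ E_B is feasible. Let F₁ ⊆ E_B be accessible with ∑_{e ∈ F₁} w e minimal among all accessible subsets of E_B, and let F₂ ⊆ E_B be SDR-feasible with ∑_{e ∈ F₂} w e minimal among all SDR-feasible subsets of E_B. Then F₁ ∪ F₂ is feasible, and ∑_{e ∈ F₁ ∪ F₂} w e ≤ 2 · ∑_{e ∈ F} w e for every feasible F ⊆ E_B. -/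
/-- The bipartite state-edge set of the digraph `r`: all pairs `(u, v)` with `r u v`. -/
def stateEdges {V : Type*} [Fintype V] (r : V → V → Prop) [DecidableRel r] :
    Finset (V × V) :=
  Finset.univ.filter fun p : V × V => r p.1 p.2

/-- `F` is SDR-feasible if the bipartite graph consisting of the state-edges of `r`
and the input-edges of `F` admits a saturating matching of the right copy of `V`. -/
def SDRFeasible {V U : Type*} [Fintype V] [DecidableEq V] [DecidableEq U]
    (r : V → V → Prop) [DecidableRel r] (F : Finset (V × U)) : Prop :=
  ∃ MA MB, SatMatching (stateEdges r) (F.image Prod.swap) MA MB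

theorem Accessible.mono {V U : Type*} {r : V → V → Prop} {F G : Finset (V × U)}
    (h : Accessible r F) (hFG : F ⊆ G) : Accessible r G := fun v =>
  let ⟨x, ⟨u, hu⟩, hx⟩ := h v
  ⟨x, ⟨u, hFG hu⟩, hx⟩

theorem SDRFeasible.mono {V U : Type*} [Fintype V] [DecidableEq V] [DecidableEq U]
    {r : V → V → Prop} [DecidableRel r] {F G : Finset (V × U)}
    (h : SDRFeasible r F) (hFG : F ⊆ G) : SDRFeasible r G :=
  let ⟨MA, MB, hA, hB, hM⟩ := h
  ⟨MA, MB, hA, hB.trans (Finset.image_subset_image hFG), hM⟩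

/-- 2-approximation: if `F₁` is a minimum-cost accessible subset of `E_B` and `F₂`
is a minimum-cost SDR-feasible subset of `E_B`, then `F₁ ∪ F₂` is feasible
(accessible and SDR-feasible) and its cost is at most twice the cost of any
feasible subset of `E_B`. -/
theorem union_two_approximation {V U : Type*}
    [Fintype V] [Fintype U] [DecidableEq V] [DecidableEq U]
    (r : V → V → Prop) [DecidableRel r]
    (E_B : Finset (V × U)) (w : V × U → ℝ) (hw : ∀ e ∈ E_B, 0 ≤ w e)
    (F₀ : Finset (V × U)) (hF₀E : F₀ ⊆ E_B)
    (hF₀ : Accessible r F₀ ∧ SDRFeasible r F₀)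
    (F₁ : Finset (V × U)) (hF₁E : F₁ ⊆ E_B) (hF₁acc : Accessible r F₁)
    (hF₁min : ∀ F ⊆ E_B, Accessible r F → ∑ e ∈ F₁, w e ≤ ∑ e ∈ F, w e)
    (F₂ : Finset (V × U)) (hF₂E : F₂ ⊆ E_B) (hF₂sdr : SDRFeasible r F₂)
    (hF₂min : ∀ F ⊆ E_B, SDRFeasible r F → ∑ e ∈ F₂, w e ≤ ∑ e ∈ F, w e) :
    (Accessible r (F₁ ∪ F₂) ∧ SDRFeasible r (F₁ ∪ F₂)) ∧
      ∀ F ⊆ E_B, Accessible r F ∧ SDRFeasible r F →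
        ∑ e ∈ F₁ ∪ F₂, w e ≤ 2 * ∑ e ∈ F, w e := by
  refine ⟨⟨hF₁acc.mono Finset.subset_union_left, hF₂sdr.mono Finset.subset_union_right⟩, ?_⟩
  rintro F hFE ⟨hacc, hsdr⟩
  have hinter : 0 ≤ ∑ e ∈ F₁ ∩ F₂, w e :=
    Finset.sum_nonneg fun e he => hw e (hF₁E (Finset.mem_inter.mp he).1)
  have hunion := Finset.sum_union_inter (s₁ := F₁) (s₂ := F₂) (f := w)
  linarith [hF₁min F hFE hacc, hF₂min F hFE hsdr]
end
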